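/- arXiv:2207.02725 — 2 statements merged into one kernel-verified Lean document; each statement's English description precedes it below -/
import Mathlib

section
/- Let n ≥ 3 and let G be a simple graph on the vertex set {0, 1, …, n−1} such that G contains every cycle edge {i, i+1 mod n} (for 0 ≤ i ≤ n−1), and such that its edges are pairwise non-crossing: there are no indices a < b < c < d in {0, …, n−1} with both {a, c} and {b, d} edges of G. Then G has at least two distinct vertices of degree exactly 2. (This is the statement that a polygon, possibly with some pairwise non-crossing diagonals drawn inside, has at least two vertices of degree 2.) -/
attribute [local instance] Classical.propDecidable

/-- Inside a chord `{i, j}` there is a vertex adjacent only to its two cycle neighbours. -/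
theorem ear_aux (A : ℕ → ℕ → Prop) (hs : ∀ i j, A i j → A j i) (hirr : ∀ i, ¬ A i i)
    (hnc : ∀ a b c d, a < b → b < c → c < d → A a c → A b d → False) :
    ∀ (l i j : ℕ), j ≤ i + l → i + 2 ≤ j → A i j →
      ∃ k, i < k ∧ k < j ∧ ∀ m, A k m → m + 1 = k ∨ m = k + 1 := by
  intro l
  induction l with
  | zero => intro i j h1 h2; omega
  | succ l ih =>
    intro i j h1 h2 hA
    by_cases h : ∀ m, A (i + 1) m → m + 1 = i + 1 ∨ m = i + 1 + 1
    · exact ⟨i + 1, by omega, by omega, h⟩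
    · push Not at h
      obtain ⟨m, hm, hm1, hm2⟩ := h
      have h3 : m ≠ i + 1 := fun e => hirr (i + 1) (by rw [e] at hm; exact hm)
      have h4 : ¬ m < i := fun hlt =>
        hnc m i (i + 1) j hlt (by omega) (by omega) (hs _ _ hm) hA
      have h5 : ¬ j < m := fun hlt =>
        hnc i (i + 1) j m (by omega) (by omega) hlt hA hm
      obtain ⟨k, hk1, hk2, hk⟩ := ih (i + 1) m (by omega) (by omega) hm
      exact ⟨k, by omega, by omega, hk⟩

theorem degree_two_aux {n : ℕ} (G : SimpleGraph (Fin n)) (v a b : Fin n) (hab : a ≠ b)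
    (ha : G.Adj v a) (hb : G.Adj v b) (h : ∀ w, G.Adj v w → w = a ∨ w = b) :
    G.degree v = 2 := by
  have : G.neighborFinset v = {a, b} := by
    ext w
    simp only [SimpleGraph.mem_neighborFinset, Finset.mem_insert, Finset.mem_singleton]
    constructor
    · exact h w
    · rintro (rfl | rfl) <;> assumption
  rw [← SimpleGraph.card_neighborFinset_eq_degree, this, Finset.card_pair hab]

/-- A polygon on `n ≥ 3` vertices, possibly with some pairwise non-crossing diagonals
drawn inside, has at least two vertices of degree 2. -/
theorem two_vertices_of_degree_two
    (n : ℕ) (hn : 3 ≤ n) (G : SimpleGraph (Fin n))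
    (hcycle : ∀ i : Fin n, G.Adj i ⟨(i.val + 1) % n, Nat.mod_lt _ (by omega)⟩)
    (hnoncross : ¬ ∃ a b c d : Fin n, a < b ∧ b < c ∧ c < d ∧ G.Adj a c ∧ G.Adj b d) :
    ∃ u v : Fin n, u ≠ v ∧ G.degree u = 2 ∧ G.degree v = 2 := by
  let A : ℕ → ℕ → Prop := fun i j => ∃ (hi : i < n) (hj : j < n), G.Adj ⟨i, hi⟩ ⟨j, hj⟩
  have hs : ∀ i j, A i j → A j i := fun i j ⟨hi, hj, h⟩ => ⟨hj, hi, h.symm⟩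
  have hirr : ∀ i, ¬ A i i := fun i ⟨_, _, h⟩ => h.ne rfl
  have hnc : ∀ a b c d, a < b → b < c → c < d → A a c → A b d → False := by
    rintro a b c d h1 h2 h3 ⟨ha, hc, h⟩ ⟨hb, hd, h'⟩
    exact hnoncross ⟨⟨a, ha⟩, ⟨b, hb⟩, ⟨c, hc⟩, ⟨d, hd⟩, h1, h2, h3, h, h'⟩
  have hsucc : ∀ i, i + 1 < n → A i (i + 1) := by
    intro i hi
    refine ⟨by omega, hi, ?_⟩
    have := hcycle ⟨i, by omega⟩
    simpa only [Nat.mod_eq_of_lt hi] using this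
  have hlast : A 0 (n - 1) := by
    refine ⟨by omega, by omega, ?_⟩
    have := hcycle ⟨n - 1, by omega⟩
    have e : (n - 1 + 1) % n = 0 := by rw [Nat.sub_add_cancel (by omega), Nat.mod_self]
    simp only [e] at this
    exact this.symm
  have hdeg : ∀ v a b (hv : v < n), a ≠ b → A v a → A v b → (∀ w, A v w → w = a ∨ w = b) →
      G.degree ⟨v, hv⟩ = 2 := by
    rintro v a b hv hab ⟨_, ha, h1⟩ ⟨_, hb, h2⟩ h
    refine degree_two_aux G _ ⟨a, ha⟩ ⟨b, hb⟩ (by simpa using hab) h1 h2 ?_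
    intro w hw
    simpa [Fin.ext_iff] using h w.1 ⟨hv, w.2, hw⟩
  have hear : ∀ i j, i + 2 ≤ j → A i j → ∃ k, ∃ hk : k < n, i < k ∧ k < j ∧
      G.degree ⟨k, hk⟩ = 2 := by
    intro i j hij hA
    obtain ⟨k, h1, h2, h⟩ := ear_aux A hs hirr hnc j i j (by omega) hij hA
    have hj : j < n := hA.2.1
    refine ⟨k, by omega, h1, h2, hdeg k (k - 1) (k + 1) (by omega) (by omega) ?_
      (hsucc k (by omega)) ?_⟩
    · have := hsucc (k - 1) (by omega)
      rw [Nat.sub_add_cancel (by omega)] at this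
      exact hs _ _ this
    · intro w hw
      have := h w hw
      omega
  have key : ∃ u v, ∃ (hu : u < n) (hv : v < n), u < v ∧
      G.degree ⟨u, hu⟩ = 2 ∧ G.degree ⟨v, hv⟩ = 2 := by
    by_cases h0 : ∀ w, A 0 w → w = 1 ∨ w = n - 1
    · obtain ⟨k, hk, h1, h2, h⟩ := hear 0 (n - 1) (by omega) hlast
      exact ⟨0, k, by omega, hk, h1,
        hdeg 0 1 (n - 1) _ (by omega) (hsucc 0 (by omega)) hlast h0, h⟩
    · push Not at h0
      obtain ⟨m, hm, hm1, hm2⟩ := h0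
      have hmn : m < n := hm.2.1
      have hm0 : m ≠ 0 := fun e => hirr 0 (by rw [e] at hm; exact hm)
      obtain ⟨k, hk, h1, h2, h⟩ := hear 0 m (by omega) hm
      by_cases hl : ∀ w, A (n - 1) w → w = n - 2 ∨ w = 0
      · refine ⟨k, n - 1, hk, by omega, by omega, h,
          hdeg (n - 1) (n - 2) 0 _ (by omega) ?_ (hs _ _ hlast) hl⟩
        have := hsucc (n - 2) (by omega)
        rw [show n - 2 + 1 = n - 1 by omega] at this
        exact hs _ _ this
      · push Not at hl
        obtain ⟨p, hp, hp1, hp2⟩ := hl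
        have hpn : p < n := hp.2.1
        have hp0 : p ≠ n - 1 := fun e => hirr (n - 1) (by rw [e] at hp; exact hp)
        have hpm : ¬ p < m := fun hlt =>
          hnc 0 p m (n - 1) (by omega) hlt (by omega) hm (hs _ _ hp)
        obtain ⟨k', hk', h1', h2', h'⟩ := hear p (n - 1) (by omega) (hs _ _ hp)
        exact ⟨k, k', hk, hk', by omega, h, h'⟩
  obtain ⟨u, v, hu, hv, huv, h1, h2⟩ := key
  exact ⟨⟨u, hu⟩, ⟨v, hv⟩, by simpa using huv.ne, h1, h2⟩
end

section
/- Let G be a finite simple graph, let u and v be distinct vertices, and let S be a finite set of vertices with u ∉ S, v ∉ S, such that every s ∈ S is adjacent to u and not adjacent to v in G, and such that the degree of u in G equals the degree of v in G plus the cardinality of S. Let G' be the graph obtained from G by deleting the edge us and adding the edge vs for every s ∈ S. Then in G' the degree of u equals the former degree of v, the degree of v equals the former degree of u, every vertex other than u and v keeps its degree, and consequently G and G' have the same degree sequence (the same multiset of vertex degrees). -/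
attribute [local instance] Classical.propDecidable

/-- Moving a set `S` of neighbours of `u` (all non-neighbours of `v`, none equal to
`u` or `v`) from `u` to `v`, where `deg u = deg v + |S|`, swaps the degrees of `u`
and `v`, keeps all other degrees, and preserves the degree sequence. -/
theorem move_pendant_neighbours_preserves_degree_sequence
    {V : Type*} [Fintype V] (G : SimpleGraph V) (u v : V) (huv : u ≠ v)
    (S : Finset V) (huS : u ∉ S) (hvS : v ∉ S)
    (hS : ∀ s ∈ S, G.Adj u s ∧ ¬ G.Adj v s)
    (hdeg : G.degree u = G.degree v + S.card)
    (G' : SimpleGraph V)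
    (hG' : G' = (G.deleteEdges {e | ∃ s ∈ S, e = s(u, s)}) ⊔
        SimpleGraph.fromEdgeSet {e | ∃ s ∈ S, e = s(v, s)}) :
    G'.degree u = G.degree v ∧ G'.degree v = G.degree u ∧
      (∀ w : V, w ≠ u → w ≠ v → G'.degree w = G.degree w) ∧
      Finset.univ.val.map (fun w : V => G'.degree w) =
        Finset.univ.val.map (fun w : V => G.degree w) := by
  have hadj : ∀ a b, G'.Adj a b ↔
      (G.Adj a b ∧ ¬ ((a = u ∧ b ∈ S) ∨ (b = u ∧ a ∈ S))) ∨
        (a = v ∧ b ∈ S) ∨ (b = v ∧ a ∈ S) := by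
    intro a b
    have h1 : ∀ x : V, (∃ s ∈ S, s(a, b) = s(x, s)) ↔
        ((a = x ∧ b ∈ S) ∨ (b = x ∧ a ∈ S)) := by
      intro x
      constructor
      · rintro ⟨s, hs, h⟩
        rcases Sym2.eq_iff.1 h with ⟨rfl, rfl⟩ | ⟨rfl, rfl⟩
        · exact Or.inl ⟨rfl, hs⟩
        · exact Or.inr ⟨rfl, hs⟩
      · rintro (⟨rfl, h⟩ | ⟨rfl, h⟩)
        · exact ⟨b, h, rfl⟩
        · exact ⟨a, h, Sym2.eq_swap⟩
    rw [hG', SimpleGraph.sup_adj, SimpleGraph.deleteEdges_adj, SimpleGraph.fromEdgeSet_adj,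
      Set.mem_setOf_eq, Set.mem_setOf_eq, h1 u, h1 v]
    constructor
    · rintro (h | h)
      · exact Or.inl h
      · exact Or.inr h.1
    · rintro (h | h)
      · exact Or.inl h
      · refine Or.inr ⟨h, ?_⟩
        rintro rfl
        rcases h with ⟨rfl, h⟩ | ⟨rfl, h⟩ <;> exact hvS h
  have hu : G'.degree u = G.degree v := by
    have hsub : S ⊆ G.neighborFinset u := by
      intro s hs
      exact (G.mem_neighborFinset u s).2 (hS s hs).1
    have : G'.neighborFinset u = G.neighborFinset u \ S := by
      ext b
      rw [Finset.mem_sdiff, SimpleGraph.mem_neighborFinset, SimpleGraph.mem_neighborFinset, hadj]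
      grind
    rw [← SimpleGraph.card_neighborFinset_eq_degree, this, Finset.card_sdiff_of_subset hsub,
      SimpleGraph.card_neighborFinset_eq_degree, hdeg, Nat.add_sub_cancel]
  have hv : G'.degree v = G.degree u := by
    have : G'.neighborFinset v = G.neighborFinset v ∪ S := by
      ext b
      rw [Finset.mem_union, SimpleGraph.mem_neighborFinset, SimpleGraph.mem_neighborFinset, hadj]
      grind
    have hd : Disjoint (G.neighborFinset v) S := by
      rw [Finset.disjoint_left]
      intro s h1 h2
      exact (hS s h2).2 ((G.mem_neighborFinset v s).1 h1)
    rw [← SimpleGraph.card_neighborFinset_eq_degree, this, Finset.card_union_of_disjoint hd,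
      SimpleGraph.card_neighborFinset_eq_degree, hdeg]
  have hw : ∀ w : V, w ≠ u → w ≠ v → G'.degree w = G.degree w := by
    intro w hwu hwv
    by_cases hwS : w ∈ S
    · have : G'.neighborFinset w = insert v ((G.neighborFinset w).erase u) := by
        ext b
        rw [Finset.mem_insert, Finset.mem_erase, SimpleGraph.mem_neighborFinset,
          SimpleGraph.mem_neighborFinset, hadj]
        grind
      have hvn : v ∉ (G.neighborFinset w).erase u := by
        intro h
        exact (hS w hwS).2 ((G.mem_neighborFinset w v).1 (Finset.mem_of_mem_erase h)).symm
      have hun : u ∈ G.neighborFinset w := (G.mem_neighborFinset w u).2 (hS w hwS).1.symm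
      rw [← SimpleGraph.card_neighborFinset_eq_degree, this, Finset.card_insert_of_notMem hvn,
        Finset.card_erase_add_one hun, SimpleGraph.card_neighborFinset_eq_degree]
    · have : G'.neighborFinset w = G.neighborFinset w := by
        ext b
        rw [SimpleGraph.mem_neighborFinset, SimpleGraph.mem_neighborFinset, hadj]
        grind
      rw [← SimpleGraph.card_neighborFinset_eq_degree, this,
        SimpleGraph.card_neighborFinset_eq_degree]
  refine ⟨hu, hv, hw, ?_⟩
  have hswap : (fun w : V => G'.degree w) = (fun w : V => G.degree w) ∘ (Equiv.swap u v) := by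
    funext w
    simp only [Function.comp]
    by_cases h1 : w = u
    · rw [h1, Equiv.swap_apply_left, hu]
    · by_cases h2 : w = v
      · rw [h2, Equiv.swap_apply_right, hv]
      · rw [Equiv.swap_apply_of_ne_of_ne h1 h2, hw w h1 h2]
  rw [hswap, ← Multiset.map_map, Multiset.map_univ_val_equiv]
end
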